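/- Fix an integer r ≥ 1 and let s, B, b_0,…,b_{2r+1} be as defined. Define d := b_0 b_1 ⋯ b_{2r+1} and integers c_0, …, c_{2r+1} as follows. For 0 ≤ i ≤ r, c_{r+1+i} := (b_{r+1−i} b_{r+2−i} ⋯ b_{r+i}) · B(P_i), where the product runs over all indices j with r+1−i ≤ j ≤ r+i (and equals 1 when i = 0), and P_i is the list of length 2(r−i)+1 formed by concatenating the pairs (b_t, b_{2r+1−t}) for t = 0, …, r−i−1 followed by the single entry b_{r−i}. For 0 ≤ i ≤ r, c_{r−i} := (b_{r+1−i} b_{r+2−i} ⋯ b_{r+1+i}) · B(Q_i), where the product runs over all indices j with r+1−i ≤ j ≤ r+1+i, and Q_i is the list of length 2(r−i) formed by concatenating the pairs (b_t, b_{2r+1−t}) for t = 0, …, r−1−i (so c_0 = b_1 b_2 ⋯ b_{2r+1}). Then d − (c_0 + c_1 + ⋯ + c_{2r+1}) = 1. (These are the degree and the first 2r+2 weights of the hypersurface X of dimension n = 2r+1 in Theorem 6.1; the identity says that K_X = O_X(1 − c_{2r+2}) where the remaining weight is c_{2r+2} = g_0.) -/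

import Mathlib

/-- Sylvester's sequence: `s 0 = 2`, `s (j+1) = s j * (s j − 1) + 1`;
it begins 2, 3, 7, 43, 1807, …. -/
def sylv : ℕ → ℕ
  | 0 => 2
  | n + 1 => sylv n * (sylv n - 1) + 1

/-- The alternating sum `B(x₁,…,x_k) = ∑_{j=0}^{k} (−1)^{k−j} x₁⋯x_j`
(the empty product being 1), characterized by `B [] = 1` and
`B (x :: xs) = x * B xs + (−1)^(length (x :: xs))`. -/
def Bsum : List ℤ → ℤ
  | [] => 1
  | x :: xs => x * Bsum xs + (-1) ^ (xs.length + 1)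

/-- `Zl r t` is the list of length `2t` formed by concatenating the pairs
`(b_{r+u}, b_{r+1−u})` for `u = 1, …, t`, where `b` are the exponents
defined inductively together with this list. -/
def Zl (r : ℕ) : ℕ → List ℤ
  | 0 => []
  | t + 1 => Zl r t ++ [1 + ((sylv (r - t) : ℤ) - 1) ^ 2 * Bsum (Zl r t), (sylv (r - t) : ℤ)]

/-- The exponents `b_0, …, b_{2r+1}`: `b_j = s_j` for `j ≤ r`, and
`b_{r+i} = 1 + (b_{r+1−i} − 1)² · B(Z_{i−1})` for `1 ≤ i ≤ r+1`
(here, for `j = r + i`, one has `b_{r+1−i} = s_{2r+1−j}`). -/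
def bexp (r j : ℕ) : ℤ :=
  if j ≤ r then (sylv j : ℤ)
  else 1 + ((sylv (2 * r + 1 - j) : ℤ) - 1) ^ 2 * Bsum (Zl r (j - r - 1))

/-- The list `L_k = (b_{r+1}, b_r, b_{r+2}, b_{r−1}, …, b_{2r+1−k}, b_k)`,
formed by concatenating the pairs `(b_{r+t}, b_{r+1−t})` for `t = 1, …, r+1−k`. -/
def Lk (r k : ℕ) : List ℤ := Zl r (r + 1 - k)

/-- `t_k := B(L_k)`. -/
def tB (r k : ℕ) : ℤ := Bsum (Lk r k)

/-- `g_k := B(reverse of L_k)`. -/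
def gB (r k : ℕ) : ℤ := Bsum (Lk r k).reverse

/-- `T_k`: the alternating sum of `B` over the suffixes of `L_k`
(the full list with sign `+`, the empty suffix contributing `+1`). -/
def TB (r k : ℕ) : ℤ :=
  ∑ m ∈ Finset.range ((Lk r k).length + 1), (-1) ^ m * Bsum ((Lk r k).drop m)

/-- `w_k := (s_k − 1)·T_k − 1`. -/
def wB (r k : ℕ) : ℤ := ((sylv k : ℤ) - 1) * TB r k - 1

/-- `PLodd r t`: the list formed by concatenating the pairs `(b_u, b_{2r+1−u})`
for `u = 0, …, t−1`. -/
def PLodd (r : ℕ) : ℕ → List ℤ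
  | 0 => []
  | t + 1 => PLodd r t ++ [bexp r t, bexp r (2 * r + 1 - t)]

theorem Bsum_append_singleton (l : List ℤ) (a : ℤ) :
    Bsum (l ++ [a]) = l.prod * a - Bsum l := by
  induction l with
  | nil => simp [Bsum, sub_eq_add_neg]
  | cons x xs ih =>
    simp only [List.cons_append, Bsum, ih, List.length_append, List.length_singleton,
      List.prod_cons]
    ring

theorem Bsum_append_pair (l : List ℤ) (a b : ℤ) :
    Bsum (l ++ [a, b]) = l.prod * a * b - l.prod * a + Bsum l := by
  have h : l ++ [a, b] = (l ++ [a]) ++ [b] := by simp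
  rw [h, Bsum_append_singleton, Bsum_append_singleton, List.prod_append, List.prod_singleton]
  ring

theorem sylv_pos (n : ℕ) : 0 < sylv n := by
  cases n <;> simp [sylv]

theorem sylv_succ_sub_one (n : ℕ) :
    (sylv (n + 1) : ℤ) - 1 = ((sylv n : ℤ) - 1) * sylv n := by
  have h := sylv_pos n
  rw [sylv]
  push_cast [Nat.cast_sub (show 1 ≤ sylv n from h)]
  ring

theorem bexp_of_le {r j : ℕ} (h : j ≤ r) : bexp r j = sylv j := if_pos h

theorem bexp_add (r t : ℕ) :
    bexp r (r + 1 + t) = 1 + ((sylv (r - t) : ℤ) - 1) ^ 2 * Bsum (Zl r t) := by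
  rw [bexp, if_neg (by omega), show 2 * r + 1 - (r + 1 + t) = r - t by omega,
    show r + 1 + t - r - 1 = t by omega]

theorem Zl_succ (r t : ℕ) :
    Zl r (t + 1) = Zl r t ++ [bexp r (r + 1 + t), (sylv (r - t) : ℤ)] := by
  rw [Zl, bexp_add]

theorem prod_Icc_bexp_succ_right (r t : ℕ) :
    ∏ j ∈ Finset.Icc (r + 1 - t) (r + 1 + t), bexp r j =
      (∏ j ∈ Finset.Icc (r + 1 - t) (r + t), bexp r j) * bexp r (r + 1 + t) := by
  rw [show r + 1 + t = (r + t) + 1 by ring, Finset.prod_Icc_succ_top (by omega)]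

theorem prod_Icc_bexp {r t : ℕ} (ht : t ≤ r + 1) :
    ∏ j ∈ Finset.Icc (r + 1 - t) (r + t), bexp r j = (Zl r t).prod := by
  induction t with
  | zero => simp [Zl]
  | succ t ih =>
    have hset : Finset.Icc (r + 1 - (t + 1)) (r + (t + 1)) =
        insert (r - t) (Finset.Icc (r + 1 - t) (r + 1 + t)) := by
      ext j
      simp only [Finset.mem_Icc, Finset.mem_insert]
      omega
    rw [hset, Finset.prod_insert (by simp only [Finset.mem_Icc]; omega),
      prod_Icc_bexp_succ_right, ih (by omega), Zl_succ, bexp_of_le (Nat.sub_le r t)]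
    simp only [List.prod_append, List.prod_cons, List.prod_nil]
    ring

/-- The sum of the weights `c_{r+1-t}, …, c_{r+t}`, scaled by `s_{r+1-t} - 1`. -/
theorem sylv_sub_one_mul_sum_weights {r t : ℕ} (ht : t ≤ r + 1) :
    ((sylv (r + 1 - t) : ℤ) - 1) *
      ∑ i ∈ Finset.range t,
        ((Zl r i).prod * Bsum (PLodd r (r - i) ++ [bexp r (r - i)]) +
          (Zl r i).prod * bexp r (r + 1 + i) * Bsum (PLodd r (r - i))) =
      (((sylv (r + 1 - t) : ℤ) - 1) * (Bsum (Zl r t) - (Zl r t).prod) - 1 + (Zl r t).prod) *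
          (PLodd r (r + 1 - t)).prod +
        ((sylv (r + 1 - t) : ℤ) - 1) * ((Zl r t).prod - Bsum (Zl r t)) *
          Bsum (PLodd r (r + 1 - t)) := by
  induction t with
  | zero => simp [Zl, Bsum]
  | succ t ih =>
    have ih := ih (by omega)
    obtain ⟨k, rfl⟩ : ∃ k, r = k + t := ⟨r - t, by omega⟩
    have hx : (sylv k : ℤ) ≠ 0 := by exact_mod_cast (sylv_pos k).ne'
    have hy := bexp_add (k + t) t
    rw [show k + t + 1 - t = k + 1 by omega, sylv_succ_sub_one, PLodd, Bsum_append_pair,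
      bexp_of_le (show k ≤ k + t by omega),
      show 2 * (k + t) + 1 - k = k + t + 1 + t by omega] at ih
    rw [Finset.sum_range_succ, Zl_succ, show k + t + 1 - (t + 1) = k by omega,
      Nat.add_sub_cancel, Bsum_append_singleton, Bsum_append_pair,
      bexp_of_le (show k ≤ k + t by omega)]
    rw [Nat.add_sub_cancel] at hy
    simp only [List.prod_append, List.prod_cons, List.prod_nil, mul_one] at ih ⊢
    apply mul_left_cancel₀ hx
    rw [mul_add, mul_add]
    generalize bexp (k + t) (k + t + 1 + t) = y at *
    generalize Bsum (Zl (k + t) t) = z at *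
    subst hy
    linear_combination ih

/-- The degree and weight identity `d − (c_0 + ⋯ + c_{2r+1}) = 1` for the hypersurface
`X` of odd dimension `n = 2r+1` in Theorem 6.1 of Esser–Totaro. Here
`d = b_0 ⋯ b_{2r+1}`, `c_{r+1+i} = (b_{r+1−i} ⋯ b_{r+i}) · B(P_i)` with
`P_i = PLodd r (r−i) ++ [b_{r−i}]`, and `c_{r−i} = (b_{r+1−i} ⋯ b_{r+1+i}) · B(Q_i)`
with `Q_i = PLodd r (r−i)`, for `0 ≤ i ≤ r`. -/
theorem odd_degree_weight_identity (r : ℕ) (hr : 1 ≤ r) :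
    (∏ j ∈ Finset.range (2 * r + 2), bexp r j) -
      ((∑ i ∈ Finset.range (r + 1),
          (∏ j ∈ Finset.Icc (r + 1 - i) (r + i), bexp r j) *
            Bsum (PLodd r (r - i) ++ [bexp r (r - i)])) +
       (∑ i ∈ Finset.range (r + 1),
          (∏ j ∈ Finset.Icc (r + 1 - i) (r + 1 + i), bexp r j) *
            Bsum (PLodd r (r - i)))) = 1 := by
  have hd : ∏ j ∈ Finset.range (2 * r + 2), bexp r j = (Zl r (r + 1)).prod := by
    rw [← prod_Icc_bexp le_rfl]
    congr 1
    ext j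
    simp only [Finset.mem_range, Finset.mem_Icc]
    omega
  have h := sylv_sub_one_mul_sum_weights (le_refl (r + 1))
  simp only [Nat.sub_self, sylv, PLodd, Bsum, List.prod_nil] at h
  rw [← Finset.sum_add_distrib, hd, Finset.sum_congr rfl fun i hi => by
    rw [prod_Icc_bexp_succ_right, prod_Icc_bexp (Finset.mem_range.mp hi).le]]
  push_cast at h
  linear_combination -h
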